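/- arXiv:2405.13713 — 5 statements merged into one kernel-verified Lean document; each statement's English description precedes it below -/
import Mathlib

section
/- Let R be a Dedekind domain with field of fractions K and G a group. Let M₁ and M₂ be MonoidAlgebra R G-modules that are torsion-free as R-modules, with M₂ finitely generated as a MonoidAlgebra R G-module, and let φ : M₁ → M₂ be a MonoidAlgebra R G-linear map. Assume that the induced K-linear map K ⊗_R M₁ → K ⊗_R M₂ is bijective, and that for every maximal ideal 𝔪 of R the induced map M₁/𝔪M₁ → M₂/𝔪M₂ is bijective. Then φ is bijective. -/
open TensorProduct

theorem TensorProduct.isLocalizedModule_mk_fractionRing (R M : Type*) [CommRing R]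
    [AddCommGroup M] [Module R M] :
    IsLocalizedModule (nonZeroDivisors R) (TensorProduct.mk R (FractionRing R) M 1) :=
  (isLocalizedModule_iff_isBaseChange (nonZeroDivisors R) (FractionRing R) _).mpr
    (TensorProduct.isBaseChange R M (FractionRing R))

section BaseChange

variable {R M N : Type*} [CommRing R] [IsDomain R] [AddCommGroup M] [Module R M]
  [AddCommGroup N] [Module R N]

theorem LinearMap.injective_of_baseChange_fractionRing
    (htf : ∀ r : R, r ≠ 0 → Function.Injective (fun m : M => r • m)) (f : M →ₗ[R] N)
    (hf : Function.Injective (f.baseChange (FractionRing R))) : Function.Injective f := by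
  have := TensorProduct.isLocalizedModule_mk_fractionRing R M
  intro x y hxy
  have h : TensorProduct.mk R (FractionRing R) M 1 x = TensorProduct.mk R (FractionRing R) M 1 y :=
    hf (by simp [hxy])
  obtain ⟨s, hs⟩ := (IsLocalizedModule.eq_iff_exists (nonZeroDivisors R) _).mp h
  exact htf s (nonZeroDivisors.coe_ne_zero s) hs

theorem LinearMap.exists_smul_mem_range_of_baseChange_fractionRing (f : M →ₗ[R] N)
    (hf : Function.Surjective (f.baseChange (FractionRing R))) (y : N) :
    ∃ r : R, r ≠ 0 ∧ r • y ∈ LinearMap.range f := by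
  have := TensorProduct.isLocalizedModule_mk_fractionRing R M
  have := TensorProduct.isLocalizedModule_mk_fractionRing R N
  obtain ⟨z, hz⟩ := hf (1 ⊗ₜ y)
  obtain ⟨⟨x, s⟩, hx⟩ := IsLocalizedModule.surj (nonZeroDivisors R)
    (TensorProduct.mk R (FractionRing R) M 1) z
  have h : TensorProduct.mk R (FractionRing R) N 1 ((s : R) • y) =
      TensorProduct.mk R (FractionRing R) N 1 (f x) := by
    have hx' := congrArg ((f.baseChange (FractionRing R)).restrictScalars R) hx
    rw [Submonoid.smul_def, map_smul] at hx'
    simpa [hz] using hx'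
  obtain ⟨t, ht⟩ := (IsLocalizedModule.eq_iff_exists (nonZeroDivisors R) _).mp h
  refine ⟨t * s, mul_ne_zero (nonZeroDivisors.coe_ne_zero t) (nonZeroDivisors.coe_ne_zero s),
    (t : R) • x, ?_⟩
  rw [map_smul, mul_smul]
  exact ht.symm

end BaseChange

/-- An element-wise torsion quotient of a finite module over an `R`-algebra `A` is killed by a
single nonzero element of `R`. -/
theorem Submodule.exists_ne_zero_forall_smul_mem {R A M : Type*} [CommRing R] [IsDomain R] [Ring A]
    [Algebra R A] [AddCommGroup M] [Module R M] [Module A M] [IsScalarTower R A M]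
    [Module.Finite A M] (N : Submodule A M) (h : ∀ y : M, ∃ r : R, r ≠ 0 ∧ r • y ∈ N) :
    ∃ r : R, r ≠ 0 ∧ ∀ y : M, r • y ∈ N := by
  have := IsScalarTower.to_smulCommClass (R := R) (A := A) (M := M)
  obtain ⟨S, hS⟩ := Module.Finite.fg_top (R := A) (M := M)
  choose c hc0 hc using h
  refine ⟨∏ y ∈ S, c y, Finset.prod_ne_zero_iff.mpr fun y _ => hc0 y, fun y => ?_⟩
  have hy : y ∈ Submodule.span A (S : Set M) := hS ▸ Submodule.mem_top
  induction hy using Submodule.span_induction with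
  | mem x hx =>
    obtain ⟨d, hd⟩ := Finset.dvd_prod_of_mem c hx
    rw [hd, mul_comm, mul_smul]
    exact N.smul_of_tower_mem d (hc x)
  | zero => simp
  | add x y _ _ hx hy => rw [smul_add]; exact N.add_mem hx hy
  | smul a x _ hx => rw [smul_comm]; exact N.smul_mem a hx

theorem Submodule.sup_smul_top_eq_top_of_isMaximal {R M : Type*} [CommRing R] [IsDedekindDomain R]
    [AddCommGroup M] [Module R M] (N : Submodule R M)
    (h : ∀ 𝔪 : Ideal R, 𝔪.IsMaximal → N ⊔ 𝔪 • ⊤ = ⊤) (I : Ideal R) (hI : I ≠ ⊥) :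
    N ⊔ I • ⊤ = ⊤ := by
  induction I using UniqueFactorizationMonoid.induction_on_prime with
  | h₁ => exact absurd rfl hI
  | h₂ J hJ => simp [Ideal.isUnit_iff.mp hJ]
  | h₃ J P hJ hP ih =>
    have hPmax : P.IsMaximal := (Ideal.isPrime_of_prime hP).isMaximal hP.ne_zero
    refine eq_top_iff.mpr ((h P hPmax).ge.trans (sup_le le_sup_left ?_))
    calc P • ⊤ = P • (N ⊔ J • ⊤) := by rw [ih hJ]
      _ = P • N ⊔ (P * J) • ⊤ := by rw [Submodule.smul_sup, Submodule.mul_smul]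
      _ ≤ N ⊔ (P * J) • ⊤ := sup_le_sup_right Submodule.smul_le_right _

theorem Submodule.range_sup_eq_top_of_mapQ_surjective {R M N : Type*} [Ring R] [AddCommGroup M]
    [AddCommGroup N] [Module R M] [Module R N] (f : M →ₗ[R] N) (p : Submodule R M)
    (q : Submodule R N) (hle : p ≤ q.comap f) (h : Function.Surjective (p.mapQ q f hle)) :
    LinearMap.range f ⊔ q = ⊤ := by
  refine eq_top_iff.mpr fun y _ => ?_
  obtain ⟨z, hz⟩ := h (q.mkQ y)
  obtain ⟨x, rfl⟩ := p.mkQ_surjective z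
  have hxy : f x - y ∈ q := (Submodule.Quotient.eq q).mp hz
  exact Submodule.mem_sup.mpr ⟨f x, ⟨x, rfl⟩, y - f x, by simpa using q.neg_mem hxy, by simp⟩

/-- Let `R` be a Dedekind domain with field of fractions `K` and `G` a group.
Let `M₁` and `M₂` be `MonoidAlgebra R G`-modules that are torsion-free as `R`-modules, with `M₂`
finitely generated as a `MonoidAlgebra R G`-module, and let `φ : M₁ → M₂` be a
`MonoidAlgebra R G`-linear map.  Assume that the induced `K`-linear map
`K ⊗[R] M₁ → K ⊗[R] M₂` is bijective, and that for every maximal ideal `𝔪` of `R` the induced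
map `M₁/𝔪M₁ → M₂/𝔪M₂` is bijective.  Then `φ` is bijective. -/
theorem statement3 (R : Type*) [CommRing R] [IsDedekindDomain R] (G : Type*) [Group G]
    (M₁ M₂ : Type*) [AddCommGroup M₁] [AddCommGroup M₂]
    [Module R M₁] [Module R M₂]
    [Module (MonoidAlgebra R G) M₁] [Module (MonoidAlgebra R G) M₂]
    [IsScalarTower R (MonoidAlgebra R G) M₁] [IsScalarTower R (MonoidAlgebra R G) M₂]
    (htf₁ : ∀ r : R, r ≠ 0 → Function.Injective (fun m : M₁ => r • m))
    (htf₂ : ∀ r : R, r ≠ 0 → Function.Injective (fun m : M₂ => r • m))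
    [Module.Finite (MonoidAlgebra R G) M₂]
    (φ : M₁ →ₗ[MonoidAlgebra R G] M₂)
    (hK : Function.Bijective
      (LinearMap.baseChange (FractionRing R) (φ.restrictScalars R)))
    (hmax : ∀ 𝔪 : Ideal R, 𝔪.IsMaximal →
      ∀ hle : (𝔪 • ⊤ : Submodule R M₁) ≤
          Submodule.comap (φ.restrictScalars R) (𝔪 • ⊤ : Submodule R M₂),
        Function.Bijective
          (Submodule.mapQ (𝔪 • ⊤ : Submodule R M₁) (𝔪 • ⊤ : Submodule R M₂)
            (φ.restrictScalars R) hle)) :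
    Function.Bijective φ := by
  refine ⟨LinearMap.injective_of_baseChange_fractionRing htf₁ (φ.restrictScalars R) hK.1, ?_⟩
  obtain ⟨r, hr0, hr⟩ := (LinearMap.range φ).exists_ne_zero_forall_smul_mem (R := R)
    (LinearMap.exists_smul_mem_range_of_baseChange_fractionRing (φ.restrictScalars R) hK.2)
  have hsup := (LinearMap.range (φ.restrictScalars R)).sup_smul_top_eq_top_of_isMaximal
    (fun 𝔪 h𝔪 => by
      have hle : (𝔪 • ⊤ : Submodule R M₁) ≤
          Submodule.comap (φ.restrictScalars R) (𝔪 • ⊤ : Submodule R M₂) := by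
        rw [← Submodule.map_le_iff_le_comap, Submodule.map_smul'']
        exact smul_mono_right 𝔪 le_top
      exact Submodule.range_sup_eq_top_of_mapQ_surjective _ _ _ hle (hmax 𝔪 h𝔪 hle).2)
    (Ideal.span {r}) (by simpa using hr0)
  have hle : (Ideal.span {r} • ⊤ : Submodule R M₂) ≤ LinearMap.range (φ.restrictScalars R) := by
    rw [Submodule.ideal_span_singleton_smul]
    rintro _ ⟨y, -, rfl⟩
    exact hr y
  rw [sup_eq_left.mpr hle] at hsup
  exact (LinearMap.range_eq_top (f := φ.restrictScalars R)).mp hsup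
end

section
/- Let S be a (possibly noncommutative, unital) ring and (P_i)_{i ∈ ι} a family of S-modules such that: (a) each P_i is finitely generated and projective as an S-module; (b) for all i ≠ j, every S-linear map P_i → P_j is zero; and (c) every nonzero S-module N admits a nonzero S-linear map P_i → N for some i ∈ ι. Then for every S-module M, defining M_i ⊆ M to be the submodule generated by the union of the ranges of all S-linear maps P_i → M, the family of submodules (M_i)_{i ∈ ι} is independent and their supremum is M; that is, M is the internal direct sum of the M_i. -/
universe u v w

/-- A linear map out of a projective module `Q` vanishes if its range lies in the span of the
ranges of maps `F a : P a → M` such that every linear map `Q → P a` is zero. -/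
theorem LinearMap.eq_zero_of_range_le_iSup_range {S Q M A : Type*} [Ring S]
    [AddCommGroup Q] [Module S Q] [Module.Projective S Q] [AddCommGroup M] [Module S M]
    {P : A → Type*} [∀ a, AddCommGroup (P a)] [∀ a, Module S (P a)]
    (F : ∀ a, P a →ₗ[S] M) (hQ : ∀ a, ∀ f : Q →ₗ[S] P a, f = 0)
    (g : Q →ₗ[S] M) (hg : LinearMap.range g ≤ ⨆ a, LinearMap.range (F a)) : g = 0 := by
  classical
  let Φ := DFinsupp.lsum ℕ F
  have hΦ : ⨆ a, LinearMap.range (F a) ≤ LinearMap.range Φ := by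
    refine iSup_le fun a => ?_
    rintro _ ⟨x, rfl⟩
    exact ⟨DFinsupp.single a x, by simp [Φ]⟩
  obtain ⟨h, hh⟩ := Module.projective_lifting_property Φ.rangeRestrict
    (g.codRestrict (LinearMap.range Φ) fun q => hΦ (hg ⟨q, rfl⟩)) Φ.surjective_rangeRestrict
  have h_zero : h = 0 := by
    ext q a
    exact LinearMap.congr_fun (hQ a ((DFinsupp.lapply a).comp h)) q
  ext q
  have hq := congrArg Subtype.val (LinearMap.congr_fun hh q)
  simpa [h_zero] using hq.symm

/-- Let `S` be a (possibly noncommutative) unital ring and `(P i)_{i : ι}` a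
family of `S`-modules such that: (a) each `P i` is finitely generated and projective; (b) for
`i ≠ j` every `S`-linear map `P i → P j` is zero; (c) every nonzero `S`-module `N` admits a
nonzero `S`-linear map `P i → N` for some `i`.  Then for every `S`-module `M`, setting `M_i`
to be the submodule generated by the union of the ranges of all `S`-linear maps `P i → M`
(i.e. `M_i = ⨆ f : P i →ₗ[S] M, range f`), the family `(M_i)` is independent and its supremum
is `M`; that is, `M` is the internal direct sum of the `M_i`. -/
theorem statement5 {ι : Type u} (S : Type v) [Ring S]
    (P : ι → Type w) [∀ i, AddCommGroup (P i)] [∀ i, Module S (P i)]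
    (hfg : ∀ i, Module.Finite S (P i))
    (hproj : ∀ i, Module.Projective S (P i))
    (hzero : ∀ i j, i ≠ j → ∀ f : P i →ₗ[S] P j, f = 0)
    (hgen : ∀ (N : Type w) [AddCommGroup N] [Module S N], (∃ n : N, n ≠ 0) →
      ∃ i, ∃ f : P i →ₗ[S] N, f ≠ 0)
    (M : Type w) [AddCommGroup M] [Module S M] :
    iSupIndep (fun i => ⨆ f : P i →ₗ[S] M, LinearMap.range f) ∧
      (⨆ i, ⨆ f : P i →ₗ[S] M, LinearMap.range f) = ⊤ := by
  constructor
  · intro i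
    rw [disjoint_iff, Submodule.eq_bot_iff]
    by_contra! hne
    obtain ⟨x, hx, hx0⟩ := hne
    obtain ⟨k, f, hf⟩ := hgen _ ⟨⟨x, hx⟩, fun h => hx0 (congrArg Subtype.val h)⟩
    have : Module.Projective S (P k) := hproj k
    apply hf
    rw [← LinearMap.cancel_left (Submodule.subtype_injective _), LinearMap.comp_zero]
    by_cases hki : k = i
    · subst hki
      refine LinearMap.eq_zero_of_range_le_iSup_range
        (A := Σ j : {j // j ≠ k}, (P j →ₗ[S] M)) (fun a => a.2)
        (fun a => hzero k a.1 a.1.2.symm) _ ?_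
      rintro _ ⟨q, rfl⟩
      rw [iSup_sigma, iSup_subtype]
      exact (f q).2.2
    · refine LinearMap.eq_zero_of_range_le_iSup_range (fun a : P i →ₗ[S] M => a)
        (fun _ => hzero k i hki) _ ?_
      rintro _ ⟨q, rfl⟩
      exact (f q).2.1
  · set T := ⨆ i, ⨆ f : P i →ₗ[S] M, LinearMap.range f
    by_contra hne
    obtain ⟨x, hx⟩ : ∃ x, x ∉ T := by
      by_contra! h
      exact hne ((Submodule.eq_top_iff').2 h)
    obtain ⟨k, f, hf⟩ := hgen (M ⧸ T)
      ⟨T.mkQ x, fun h => hx ((Submodule.Quotient.mk_eq_zero T).1 h)⟩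
    have : Module.Projective S (P k) := hproj k
    obtain ⟨h, rfl⟩ := Module.projective_lifting_property T.mkQ f T.mkQ_surjective
    apply hf
    ext q
    have hle : LinearMap.range h ≤ T :=
      (le_iSup (fun f : P k →ₗ[S] M => LinearMap.range f) h).trans
        (le_iSup (fun i => ⨆ f : P i →ₗ[S] M, LinearMap.range f) k)
    exact (Submodule.Quotient.mk_eq_zero T).2 (hle ⟨q, rfl⟩)
end

section
/- Let R be a nontrivial commutative ring, J a group, and N a normal subgroup of J. Let κ be a module over MonoidAlgebra R J such that the natural ring map R → End_{MonoidAlgebra R N}(κ), sending r to multiplication by r on κ regarded as a MonoidAlgebra R N-module by restriction, is bijective. Let Q be a module over MonoidAlgebra R J on which N acts trivially, which is finitely generated and projective as an R-module, and which is indecomposable as a MonoidAlgebra R J-module. Then κ ⊗_R Q, equipped with the diagonal J-action g·(v ⊗ w) = (g·v) ⊗ (g·w), is an indecomposable MonoidAlgebra R J-module. -/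
open TensorProduct

/-- The action of a group element `g : G` on a module `M` over the group algebra
`MonoidAlgebra R G`, as an `R`-linear endomorphism of `M`. -/
noncomputable def moduleRep (R : Type*) [CommRing R] (G : Type*) [Group G]
    (M : Type*) [AddCommGroup M] [Module R M] [Module (MonoidAlgebra R G) M]
    [IsScalarTower R (MonoidAlgebra R G) M] : Representation R G M where
  toFun g :=
    { toFun := fun m => MonoidAlgebra.of R G g • m
      map_add' := fun x y => smul_add _ x y
      map_smul' := fun r m => smul_comm (MonoidAlgebra.of R G g) r m }
  map_one' := LinearMap.ext fun m => by
    show MonoidAlgebra.of R G 1 • m = m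
    rw [map_one, one_smul]
  map_mul' g h := LinearMap.ext fun m => by
    show MonoidAlgebra.of R G (g * h) • m = MonoidAlgebra.of R G g • MonoidAlgebra.of R G h • m
    rw [map_mul, mul_smul]

@[simp] theorem moduleRep_apply (R : Type*) [CommRing R] (G : Type*) [Group G]
    (M : Type*) [AddCommGroup M] [Module R M] [Module (MonoidAlgebra R G) M]
    [IsScalarTower R (MonoidAlgebra R G) M] (g : G) (m : M) :
    moduleRep R G M g m = MonoidAlgebra.of R G g • m := rfl

/-- A module is indecomposable if it is nonzero and is not the internal direct sum of two
nonzero submodules. -/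
def IsIndecomposableModule (S : Type*) [Semiring S] (M : Type*) [AddCommMonoid M]
    [Module S M] : Prop :=
  Nontrivial M ∧ ∀ p q : Submodule S M, IsCompl p q → p = ⊥ ∨ q = ⊥

/-- The natural map from `R` to the endomorphisms of `κ` regarded as a module over
`MonoidAlgebra R N` by restriction (encoded as `R`-linear endomorphisms commuting with the
action of every element of the subgroup `N`), sending `r` to multiplication by `r`. -/
noncomputable def scalarToEquivEnd (R : Type*) [CommRing R] {J : Type*} [Group J]
    (N : Subgroup J) (κ : Type*) [AddCommGroup κ] [Module R κ]
    [Module (MonoidAlgebra R J) κ] [IsScalarTower R (MonoidAlgebra R J) κ] (r : R) :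
    {f : κ →ₗ[R] κ // ∀ n ∈ N, ∀ v : κ,
      f (MonoidAlgebra.of R J n • v) = MonoidAlgebra.of R J n • f v} :=
  ⟨r • LinearMap.id, fun n _ v => by
    simp only [LinearMap.smul_apply, LinearMap.id_apply]
    exact smul_comm r (MonoidAlgebra.of R J n) v⟩

section TensorFactor

variable {R : Type*} [CommRing R] {κ : Type*} [AddCommGroup κ] [Module R κ]
  {Q : Type*} [AddCommGroup Q] [Module R Q]

/-- If `R` acts faithfully on `κ` and `Q` is projective, an element `w` of `Q` is determined by
the elements `v ⊗ₜ w` of `κ ⊗[R] Q`. -/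
theorem eq_of_forall_tmul_eq [FaithfulSMul R κ] [Module.Projective R Q] {w w' : Q}
    (h : ∀ v : κ, v ⊗ₜ[R] w = v ⊗ₜ[R] w') : w = w' := by
  refine sub_eq_zero.1 ((Module.forall_dual_apply_eq_zero_iff R _).1 fun ξ => ?_)
  refine FaithfulSMul.eq_of_smul_eq_smul (α := κ) fun v => ?_
  have := congrArg ((TensorProduct.rid R κ).toLinearMap ∘ₗ ξ.lTensor κ) (h v)
  simpa [sub_smul, sub_eq_zero] using this

/-- If every endomorphism of `κ` commuting with all the `a i` is a scalar, then every endomorphism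
of `κ ⊗[R] Q` commuting with all the `a i ⊗ 1` acts on the second factor only. -/
theorem exists_lTensor_eq [FaithfulSMul R κ] [Module.Finite R Q] [Module.Projective R Q]
    {ι : Type*} (a : ι → Module.End R κ)
    (hscalar : ∀ g : Module.End R κ, (∀ i v, g (a i v) = a i (g v)) → ∃ r : R, ∀ v, g v = r • v)
    (f : Module.End R (κ ⊗[R] Q))
    (hf : ∀ i x, f ((a i).rTensor Q x) = (a i).rTensor Q (f x)) :
    ∃ φ : Module.End R Q, f = φ.lTensor κ := by
  obtain ⟨n, s, t, -, -, hst⟩ := Module.Finite.exists_comp_eq_id_of_projective R Q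
  have hcoeff (w : Q) (j : Fin n) : ∃ r : R, ∀ v : κ,
      TensorProduct.rid R κ ((LinearMap.proj j ∘ₗ t).lTensor κ (f (v ⊗ₜ w))) = r • v := by
    refine hscalar ((TensorProduct.rid R κ).toLinearMap ∘ₗ (LinearMap.proj j ∘ₗ t).lTensor κ ∘ₗ
      f ∘ₗ (TensorProduct.mk R κ Q).flip w) fun i v => ?_
    have hcomm (x : κ ⊗[R] Q) : TensorProduct.rid R κ
        ((LinearMap.proj j ∘ₗ t).lTensor κ ((a i).rTensor Q x)) =
        a i (TensorProduct.rid R κ ((LinearMap.proj j ∘ₗ t).lTensor κ x)) := by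
      induction x with
      | zero => simp
      | tmul v w => simp
      | add x y hx hy => simp only [map_add, hx, hy]
    have := hf i (v ⊗ₜ w)
    rw [LinearMap.rTensor_tmul] at this
    simp [this, hcomm]
  have hexpand (x : κ ⊗[R] Q) : x = ∑ j, TensorProduct.rid R κ
      ((LinearMap.proj j ∘ₗ t).lTensor κ x) ⊗ₜ s (Pi.single j 1) := by
    induction x with
    | zero => simp
    | tmul v w =>
      have hw : w = ∑ j, t w j • s (Pi.single j 1) := by
        simp only [← map_smul, ← map_sum]
        rw [← pi_eq_sum_univ']
        exact (LinearMap.congr_fun hst w).symm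
      conv_lhs => rw [hw]
      simp [TensorProduct.tmul_sum, TensorProduct.smul_tmul]
    | add x y hx hy =>
      simp only [map_add, TensorProduct.add_tmul, Finset.sum_add_distrib, ← hx, ← hy]
  have hslice (w : Q) : ∃ u : Q, ∀ v : κ, f (v ⊗ₜ w) = v ⊗ₜ u := by
    choose r hr using hcoeff w
    refine ⟨∑ j, r j • s (Pi.single j 1), fun v => ?_⟩
    rw [hexpand (f (v ⊗ₜ w))]
    simp only [hr, TensorProduct.tmul_sum, TensorProduct.smul_tmul]
  choose φ hφ using hslice
  refine ⟨{ toFun := φ, map_add' := fun x y => ?_, map_smul' := fun r x => ?_ },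
    TensorProduct.ext' fun v w => hφ w v⟩
  · refine eq_of_forall_tmul_eq (R := R) (κ := κ) fun v => ?_
    rw [← hφ, TensorProduct.tmul_add, map_add, hφ, hφ, TensorProduct.tmul_add]
  · refine eq_of_forall_tmul_eq (R := R) (κ := κ) fun v => ?_
    rw [← hφ, TensorProduct.tmul_smul, map_smul, hφ, RingHom.id_apply, TensorProduct.tmul_smul]

/-- Tensoring with a faithful module is injective on endomorphisms of a projective module. -/
theorem lTensor_injective_of_faithfulSMul [FaithfulSMul R κ] [Module.Projective R Q] :
    Function.Injective fun φ : Module.End R Q => φ.lTensor κ := fun φ ψ h =>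
  LinearMap.ext fun w => eq_of_forall_tmul_eq (R := R) (κ := κ) fun v => by
    simpa using LinearMap.congr_fun h (v ⊗ₜ w)

end TensorFactor

/-- The idempotent endomorphisms of an indecomposable module are `0` and `1`. -/
theorem IsIndecomposableModule.eq_zero_or_eq_one {S M : Type*} [Ring S] [AddCommGroup M]
    [Module S M] (h : IsIndecomposableModule S M) {e : Module.End S M}
    (he : IsIdempotentElem e) : e = 0 ∨ e = 1 := by
  rcases h.2 _ _ (LinearMap.IsIdempotentElem.isCompl he) with h | h
  · exact .inl (LinearMap.range_eq_bot.1 h)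
  · refine .inr (LinearMap.ext fun x => LinearMap.ker_eq_bot.1 h ?_)
    exact LinearMap.congr_fun he x

/-- A nonzero module whose only idempotent endomorphisms are `0` and `1` is indecomposable. -/
theorem isIndecomposableModule_of_isIdempotentElem {S M : Type*} [Ring S] [AddCommGroup M]
    [Module S M] [Nontrivial M]
    (h : ∀ e : Module.End S M, IsIdempotentElem e → e = 0 ∨ e = 1) :
    IsIndecomposableModule S M := by
  refine ⟨inferInstance, fun p q hpq => ?_⟩
  rcases h _ (Submodule.isIdempotentElem_projection hpq) with he | he
  · left
    rw [← Submodule.range_projection hpq, he, LinearMap.range_zero]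
  · right
    rw [← Submodule.ker_projection hpq, he]
    exact LinearMap.ker_id

/-- An `R`-linear endomorphism commuting with the action of every group element is linear over the
group algebra. -/
def LinearMap.toMonoidAlgebraEnd {R G M : Type*} [CommRing R] [Group G] [AddCommGroup M]
    [Module R M] [Module (MonoidAlgebra R G) M] [IsScalarTower R (MonoidAlgebra R G) M]
    (φ : Module.End R M)
    (hφ : ∀ g x, φ (MonoidAlgebra.of R G g • x) = MonoidAlgebra.of R G g • φ x) :
    Module.End (MonoidAlgebra R G) M where
  toFun := φ
  map_add' := φ.map_add
  map_smul' a x := by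
    induction a using MonoidAlgebra.induction_on with
    | of g => exact hφ g x
    | add a b ha hb => simp_all [add_smul]
    | smul r a ha => simp_all

/-- Let `R` be a nontrivial commutative ring, `J` a group, and `N` a normal
subgroup of `J`.  Let `κ` be a `MonoidAlgebra R J`-module such that the natural ring map
`R → End_{MonoidAlgebra R N}(κ)` is bijective.  Let `Q` be a `MonoidAlgebra R J`-module on
which `N` acts trivially, finitely generated and projective over `R`, and indecomposable over
`MonoidAlgebra R J`.  Then `κ ⊗[R] Q` with the diagonal `J`-action is an indecomposable
`MonoidAlgebra R J`-module. -/
theorem statement6 (R : Type*) [CommRing R] [Nontrivial R] (J : Type*) [Group J]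
    (N : Subgroup J) [N.Normal]
    (κ : Type*) [AddCommGroup κ] [Module R κ] [Module (MonoidAlgebra R J) κ]
    [IsScalarTower R (MonoidAlgebra R J) κ]
    (hκ : Function.Bijective (scalarToEquivEnd R N κ))
    (Q : Type*) [AddCommGroup Q] [Module R Q] [Module (MonoidAlgebra R J) Q]
    [IsScalarTower R (MonoidAlgebra R J) Q]
    (hQtriv : ∀ n ∈ N, ∀ w : Q, MonoidAlgebra.of R J n • w = w)
    [Module.Finite R Q] [Module.Projective R Q]
    (hQind : IsIndecomposableModule (MonoidAlgebra R J) Q) :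
    IsIndecomposableModule (MonoidAlgebra R J)
      ((moduleRep R J κ).tprod (moduleRep R J Q)).asModule := by
  have : FaithfulSMul R κ := ⟨fun h => hκ.1 (Subtype.ext (LinearMap.ext h))⟩
  have hQ : Nontrivial Q := hQind.1
  set ρ := (moduleRep R J κ).tprod (moduleRep R J Q) with hρ
  have hnt : Nontrivial ρ.asModule := by
    by_contra hcon
    have hsub : Subsingleton (κ ⊗[R] Q) := not_nontrivial_iff_subsingleton.1 hcon
    obtain ⟨w, hw⟩ := exists_ne (0 : Q)
    exact hw (eq_of_forall_tmul_eq (R := R) (κ := κ) fun v => Subsingleton.elim _ _)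
  refine isIndecomposableModule_of_isIdempotentElem fun e he => ?_
  let f : Module.End R (κ ⊗[R] Q) :=
    ρ.asModuleEquiv.toLinearMap ∘ₗ e.restrictScalars R ∘ₗ ρ.asModuleEquiv.symm.toLinearMap
  have hf (g : J) (x : κ ⊗[R] Q) : f (ρ g x) = ρ g (f x) := by
    change ρ.asModuleEquiv (e (ρ.asModuleEquiv.symm (ρ g x))) = _
    rw [Representation.asModuleEquiv_symm_map_rho, map_smul, Representation.asModuleEquiv_map_smul,
      Representation.asAlgebraHom_of]
    rfl
  obtain ⟨φ, hφ⟩ := exists_lTensor_eq (fun n : N => moduleRep R J κ n)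
    (fun g hg => by
      obtain ⟨r, hr⟩ := hκ.2 ⟨g, fun n hn v => hg ⟨n, hn⟩ v⟩
      exact ⟨r, fun v => (LinearMap.congr_fun (congrArg Subtype.val hr) v).symm⟩) f
    (fun n => by
      have hn : ρ n = (moduleRep R J κ n).rTensor Q :=
        congrArg (TensorProduct.map _) (LinearMap.ext (hQtriv n n.2))
      simpa only [hn] using hf n)
  have hφidem : φ * φ = φ := lTensor_injective_of_faithfulSMul (κ := κ) <| by
    simp only [Module.End.mul_eq_comp, LinearMap.lTensor_comp, ← hφ]
    exact LinearMap.ext fun x => LinearMap.congr_fun he x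
  have hφcomm (g : J) (w : Q) :
      φ (MonoidAlgebra.of R J g • w) = MonoidAlgebra.of R J g • φ w := by
    refine eq_of_forall_tmul_eq (R := R) (κ := κ) fun v => ?_
    have := hf g ((MonoidAlgebra.of R J g⁻¹ • v) ⊗ₜ w)
    simpa only [hφ, hρ, Representation.tprod_apply, TensorProduct.map_tmul,
      LinearMap.lTensor_tmul, moduleRep_apply, smul_smul, ← map_mul, mul_inv_cancel, map_one,
      one_smul] using this
  have hidem : IsIdempotentElem (φ.toMonoidAlgebraEnd hφcomm) :=
    LinearMap.ext fun w => LinearMap.congr_fun hφidem w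
  refine (hQind.eq_zero_or_eq_one hidem).imp (fun h => ?_) (fun h => ?_)
  · have h0 : φ = 0 := LinearMap.ext fun w => LinearMap.congr_fun h w
    rw [h0, LinearMap.lTensor_zero] at hφ
    exact LinearMap.ext fun x => LinearMap.congr_fun hφ x
  · have h1 : φ = LinearMap.id := LinearMap.ext fun w => LinearMap.congr_fun h w
    rw [h1, LinearMap.lTensor_id] at hφ
    exact LinearMap.ext fun x => LinearMap.congr_fun hφ x
end

section
/- Let R be a commutative ring, J a group, and N a normal subgroup of J. Let κ be a module over MonoidAlgebra R J such that the natural ring map R → End_{MonoidAlgebra R N}(κ) is bijective, and let Q be a module over MonoidAlgebra R J on which N acts trivially and which is finitely generated and projective as an R-module. Then the map Q → Hom_{MonoidAlgebra R N}(κ, κ ⊗_R Q) sending w to the map v ↦ v ⊗ w is bijective, and it is J-equivariant, where J acts on Hom_{MonoidAlgebra R N}(κ, κ ⊗_R Q) by (g·f)(v) = g·f(g⁻¹·v) and κ ⊗_R Q carries the diagonal J-action. -/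
open TensorProduct

/-- The map `Q → Hom_{MonoidAlgebra R N}(κ, κ ⊗[R] Q)` sending `w` to `v ↦ v ⊗ w`.  Here
`Hom_{MonoidAlgebra R N}` is encoded as the `R`-linear maps `κ → κ ⊗[R] Q` intertwining the
action of each `n ∈ N` on `κ` with the diagonal action on `κ ⊗[R] Q` (which, as `N` acts
trivially on `Q`, is the restricted `N`-action). -/
noncomputable def toHomNE (R : Type*) [CommRing R] {J : Type*} [Group J] (N : Subgroup J)
    (κ Q : Type*) [AddCommGroup κ] [Module R κ] [Module (MonoidAlgebra R J) κ]
    [IsScalarTower R (MonoidAlgebra R J) κ]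
    [AddCommGroup Q] [Module R Q] [Module (MonoidAlgebra R J) Q]
    [IsScalarTower R (MonoidAlgebra R J) Q]
    (hQtriv : ∀ n ∈ N, ∀ w : Q, MonoidAlgebra.of R J n • w = w) (w : Q) :
    {f : κ →ₗ[R] κ ⊗[R] Q // ∀ n ∈ N, ∀ v : κ,
      f (MonoidAlgebra.of R J n • v) =
        ((moduleRep R J κ).tprod (moduleRep R J Q)) n (f v)} :=
  ⟨(TensorProduct.mk R κ Q).flip w, fun n hn v => by
    have h := hQtriv n hn w
    rw [MonoidAlgebra.of_apply] at h
    simp [Representation.tprod_apply, h]⟩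

/-- Contraction of the second factor of `M ⊗[R] Q` against a linear form on `Q`. -/
noncomputable def rightContraction {R : Type*} [CommRing R] (M : Type*) {Q : Type*}
    [AddCommGroup M] [Module R M] [AddCommGroup Q] [Module R Q] (ℓ : Q →ₗ[R] R) :
    M ⊗[R] Q →ₗ[R] M :=
  (TensorProduct.rid R M).toLinearMap ∘ₗ ℓ.lTensor M

@[simp] theorem rightContraction_tmul {R : Type*} [CommRing R] {M Q : Type*}
    [AddCommGroup M] [Module R M] [AddCommGroup Q] [Module R Q] (ℓ : Q →ₗ[R] R) (m : M) (q : Q) :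
    rightContraction M ℓ (m ⊗ₜ[R] q) = ℓ q • m := by
  simp [rightContraction]

/-- A finitely generated projective module has a finite dual basis. -/
theorem exists_finite_dual_basis (R Q : Type*) [CommRing R] [AddCommGroup Q] [Module R Q]
    [Module.Finite R Q] [Module.Projective R Q] :
    ∃ (n : ℕ) (ℓ : Fin n → Q →ₗ[R] R) (q : Fin n → Q), ∀ w : Q, ∑ i, ℓ i w • q i = w := by
  obtain ⟨n, f, g, -, -, hfg⟩ := Module.Finite.exists_comp_eq_id_of_projective R Q
  refine ⟨n, fun i => LinearMap.proj i ∘ₗ g, fun i => f (Pi.single i 1), fun w => ?_⟩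
  have h : ∑ i, g w i • (Pi.single i 1 : Fin n → R) = g w := by
    simpa using (pi_eq_sum_univ' (g w)).symm
  calc ∑ i, g w i • f (Pi.single i 1) = f (g w) := by
        conv_rhs => rw [← h]
        simp only [map_sum, map_smul]
    _ = w := LinearMap.congr_fun hfg w

/-- Elements of `M ⊗[R] Q` are recovered from their contractions against a dual basis of `Q`. -/
theorem sum_rightContraction_tmul {R : Type*} [CommRing R] {M Q ι : Type*} [Fintype ι]
    [AddCommGroup M] [Module R M] [AddCommGroup Q] [Module R Q]
    (ℓ : ι → Q →ₗ[R] R) (q : ι → Q) (h : ∀ w : Q, ∑ i, ℓ i w • q i = w) (x : M ⊗[R] Q) :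
    ∑ i, rightContraction M (ℓ i) x ⊗ₜ[R] q i = x := by
  induction x with
  | zero => simp
  | tmul m w =>
    simp only [rightContraction_tmul, TensorProduct.smul_tmul]
    rw [← TensorProduct.tmul_sum, h]
  | add x y hx hy =>
    simp only [map_add, TensorProduct.add_tmul, Finset.sum_add_distrib, hx, hy]

/-- Contraction commutes with every group element acting trivially on the second factor. -/
theorem rightContraction_tprod {R : Type*} [CommRing R] {G M Q : Type*} [Monoid G]
    [AddCommGroup M] [Module R M] [AddCommGroup Q] [Module R Q]
    (ρ : Representation R G M) (σ : Representation R G Q) (ℓ : Q →ₗ[R] R) (g : G)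
    (hg : ∀ w, σ g w = w) (x : M ⊗[R] Q) :
    rightContraction M ℓ (ρ.tprod σ g x) = ρ g (rightContraction M ℓ x) := by
  induction x with
  | zero => simp
  | tmul m w => simp [Representation.tprod_apply, hg]
  | add x y hx hy => simp only [map_add, hx, hy]

/-- Let `R` be a commutative ring, `J` a group, and `N` a normal subgroup of
`J`.  Let `κ` be a `MonoidAlgebra R J`-module such that the natural ring map
`R → End_{MonoidAlgebra R N}(κ)` is bijective, and let `Q` be a `MonoidAlgebra R J`-module on
which `N` acts trivially and which is finitely generated and projective over `R`.  Then the map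
`Q → Hom_{MonoidAlgebra R N}(κ, κ ⊗[R] Q)`, `w ↦ (v ↦ v ⊗ w)`, is bijective and
`J`-equivariant, where `J` acts on the Hom-space by `(g·f)(v) = g·f(g⁻¹·v)` and `κ ⊗[R] Q`
carries the diagonal `J`-action. -/
theorem statement7 (R : Type*) [CommRing R] (J : Type*) [Group J]
    (N : Subgroup J) [N.Normal]
    (κ : Type*) [AddCommGroup κ] [Module R κ] [Module (MonoidAlgebra R J) κ]
    [IsScalarTower R (MonoidAlgebra R J) κ]
    (hκ : Function.Bijective (scalarToEquivEnd R N κ))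
    (Q : Type*) [AddCommGroup Q] [Module R Q] [Module (MonoidAlgebra R J) Q]
    [IsScalarTower R (MonoidAlgebra R J) Q]
    (hQtriv : ∀ n ∈ N, ∀ w : Q, MonoidAlgebra.of R J n • w = w)
    [Module.Finite R Q] [Module.Projective R Q] :
    Function.Bijective (toHomNE R N κ Q hQtriv) ∧
      ∀ (g : J) (w : Q) (v : κ),
        (toHomNE R N κ Q hQtriv (MonoidAlgebra.of R J g • w)).1 v =
          ((moduleRep R J κ).tprod (moduleRep R J Q)) g
            ((toHomNE R N κ Q hQtriv w).1 (MonoidAlgebra.of R J g⁻¹ • v)) := by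
  obtain ⟨n, ℓ, q, hq⟩ := exists_finite_dual_basis R Q
  refine ⟨⟨fun w w' h => ?_, fun φ => ?_⟩, fun g w v => ?_⟩
  · have hv (v : κ) : v ⊗ₜ[R] w = v ⊗ₜ[R] w' := LinearMap.congr_fun (congrArg Subtype.val h) v
    have hℓ (i : Fin n) : ℓ i w = ℓ i w' :=
      hκ.injective <| Subtype.ext <| LinearMap.ext fun v => by
        simpa [scalarToEquivEnd] using congrArg (rightContraction κ (ℓ i)) (hv v)
    rw [← hq w, ← hq w']
    simp only [hℓ]
  · have hr (i : Fin n) : ∃ r : R, ∀ v, rightContraction κ (ℓ i) (φ.1 v) = r • v := by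
      obtain ⟨r, hr⟩ := hκ.surjective ⟨rightContraction κ (ℓ i) ∘ₗ φ.1, fun m hm v => by
        rw [LinearMap.comp_apply, φ.2 m hm,
          rightContraction_tprod _ _ _ _ fun w => hQtriv m hm w]
        rfl⟩
      exact ⟨r, fun v => (LinearMap.congr_fun (congrArg Subtype.val hr) v).symm⟩
    choose r hr using hr
    refine ⟨∑ i, r i • q i, Subtype.ext <| LinearMap.ext fun v => ?_⟩
    rw [← sum_rightContraction_tmul ℓ q hq (φ.1 v)]
    simp only [hr, TensorProduct.smul_tmul, ← TensorProduct.tmul_sum]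
    rfl
  · change v ⊗ₜ[R] _ = (MonoidAlgebra.of R J g • MonoidAlgebra.of R J g⁻¹ • v) ⊗ₜ[R] _
    rw [← mul_smul, ← map_mul, mul_inv_cancel, map_one, one_smul]
    rfl
end

section
/- Let p be a prime and let A = Z̄[1/p] denote the ring of algebraic integers with p inverted, i.e. the localization away from p of the integral closure of ℤ in ℂ. Let H be a finite group and K a normal subgroup of H such that the quotient H/K is abelian of order coprime to p. If the group algebra MonoidAlgebra A K has no central idempotents other than 0 and 1, then the group algebra MonoidAlgebra A H has no central idempotents other than 0 and 1. -/
/-- The ring `Z̄[1/p]` of algebraic integers with `p` inverted: the localization away from `p`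
of the integral closure of `ℤ` in `ℂ`. -/
abbrev ZbarInvP (p : ℕ) : Type :=
  Localization.Away ((p : ℕ) : integralClosure ℤ ℂ)

namespace MonoidAlgebra

/-- The automorphism of `R[G]` multiplying each group element by the value of a linear character,
as an algebra endomorphism. -/
noncomputable def twist {R G : Type*} [CommRing R] [Group G] (ψ : G →* R) :
    MonoidAlgebra R G →ₐ[R] MonoidAlgebra R G :=
  MonoidAlgebra.lift R (MonoidAlgebra R G) G
    { toFun := fun g => single g (ψ g)
      map_one' := by simp [one_def]
      map_mul' := fun a b => by simp [single_mul_single] }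

lemma coeff_twist {R G : Type*} [CommRing R] [Group G] (ψ : G →* R) (x : MonoidAlgebra R G)
    (g : G) : (twist ψ x).coeff g = ψ g * x.coeff g := by
  classical
  induction x using MonoidAlgebra.induction_linear with
  | zero => simp
  | add x y hx hy => simp [hx, hy, mul_add]
  | single a r =>
    simp only [twist, lift_single, MonoidHom.coe_mk, OneHom.coe_mk, coeff_smul_apply,
      coeff_single, Finsupp.single_apply, smul_eq_mul]
    split_ifs with h
    · rw [h, mul_comm]
    · simp

lemma coeff_mul_mem {R G : Type*} [CommRing R] [Group G] {I J : Ideal R}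
    {x y : MonoidAlgebra R G} (hx : ∀ g, x.coeff g ∈ I) (hy : ∀ g, y.coeff g ∈ J) (g : G) :
    (x * y).coeff g ∈ I * J := by
  classical
  rw [coeff_mul]
  refine Ideal.sum_mem _ fun a _ => Ideal.sum_mem _ fun b _ => ?_
  dsimp only
  split_ifs
  · exact Ideal.mul_mem_mul (hx a) (hy b)
  · exact Ideal.zero_mem _

/-- Over a domain, an element of the group algebra equal to its own cube and with coefficients in a
proper ideal vanishes. -/
lemma eq_zero_of_mul_mul_self {R G : Type*} [CommRing R] [IsDomain R] [Group G]
    {P : Ideal R} (hP : P ≠ ⊤) {x : MonoidAlgebra R G} (hx : x * x * x = x)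
    (hxP : ∀ g, x.coeff g ∈ P) : x = 0 := by
  classical
  let J : Ideal R := Ideal.span (x.coeff '' x.coeff.support)
  have hxJ : ∀ g, x.coeff g ∈ J := fun g => by
    by_cases h : x.coeff g = 0
    · rw [h]; exact J.zero_mem
    · exact Ideal.subset_span ⟨g, by simpa using h, rfl⟩
  have hJP : J ≤ P := Ideal.span_le.2 (by rintro _ ⟨g, -, rfl⟩; exact hxP g)
  have hfg : J.FG := Submodule.fg_span ((Finset.finite_toSet _).image _)
  have hJ3 : J ≤ J * J * J := Ideal.span_le.2 (by
    rintro _ ⟨g, -, rfl⟩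
    rw [← hx]
    exact coeff_mul_mem (coeff_mul_mem hxJ hxJ) hxJ g)
  have hJJ : IsIdempotentElem J := le_antisymm Ideal.mul_le_left (hJ3.trans Ideal.mul_le_left)
  rcases (Ideal.isIdempotentElem_iff_eq_bot_or_top J hfg).1 hJJ with h | h
  · ext g
    simpa [h] using hxJ g
  · exact absurd (top_le_iff.1 (h ▸ hJP)) hP

/-- Two commuting idempotents of a group algebra over a domain which are congruent modulo a proper
ideal are equal. -/
lemma eq_of_idempotent_of_sub_mem {R G : Type*} [CommRing R] [IsDomain R] [Group G]
    {P : Ideal R} (hP : P ≠ ⊤) {e f : MonoidAlgebra R G} (he : e * e = e) (hf : f * f = f)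
    (hef : f * e = e * f) (h : ∀ g, (e - f).coeff g ∈ P) : e = f := by
  refine sub_eq_zero.1 (eq_zero_of_mul_mul_self hP ?_ h)
  have h1 : e * f * e = e * f := by rw [mul_assoc, hef, ← mul_assoc, he]
  have h2 : e * f * f = e * f := by rw [mul_assoc, hf]
  simp only [mul_sub, sub_mul, he, hf, hef, h1, h2]
  abel

/-- A central element of `R[G]` supported on a subgroup `K` comes from a central element
of `R[K]`. -/
lemma exists_central_mapDomain_eq {R G : Type*} [CommRing R] [Group G] (K : Subgroup G)
    {e : MonoidAlgebra R G} (he : e ∈ Subring.center (MonoidAlgebra R G))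
    (hsupp : ∀ g ∉ K, e.coeff g = 0) :
    ∃ e' ∈ Subring.center (MonoidAlgebra R K), mapDomainRingHom R K.subtype e' = e := by
  have hmap : mapDomainRingHom R K.subtype (comapDomain K.subtype K.subtype_injective e) = e := by
    refine mapDomain_comapDomain (fun g hg => ?_) K.subtype_injective
    by_contra hgK
    exact (by simpa using hg : e.coeff g ≠ 0) (hsupp g fun h => hgK ⟨⟨g, h⟩, rfl⟩)
  refine ⟨_, Subring.mem_center_iff.2 fun y => ?_, hmap⟩
  apply mapDomain_injective (R := R) K.subtype_injective
  change mapDomainRingHom R K.subtype _ = mapDomainRingHom R K.subtype _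
  rw [map_mul, map_mul, hmap]
  exact Subring.mem_center_iff.1 he _

end MonoidAlgebra

/-- If a domain `R` contains enough roots of unity for the finite abelian group `G`, then an element
`q ≠ 1` of `G` is separated from `1` by a linear character which is trivial modulo a proper ideal
of `R`, provided no prime divisor of the order of `G` is invertible in `R`. -/
lemma exists_monoidHom_ne_one_and_sub_one_mem {R G : Type*} [CommRing R]
    [CommGroup G] [Finite G] [HasEnoughRootsOfUnity R (Monoid.exponent G)]
    (hR : ∀ ℓ : ℕ, ℓ.Prime → ℓ ∣ Nat.card G → ¬ IsUnit (ℓ : R)) {q : G} (hq : q ≠ 1) :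
    ∃ (ψ : G →* R) (P : Ideal R), P ≠ ⊤ ∧ ψ q ≠ 1 ∧ ∀ g, 1 - ψ g ∈ P := by
  obtain ⟨χ, hχ⟩ := CommGroup.exists_apply_ne_one_of_hasEnoughRootsOfUnity G R hq
  have hexp : Monoid.exponent G ≠ 0 := Monoid.exponent_ne_zero_of_finite
  have hord : orderOf (χ q) ∣ Monoid.exponent G :=
    (orderOf_map_dvd χ q).trans (Monoid.order_dvd_exponent q)
  obtain ⟨ℓ, hℓ, hℓd⟩ := Nat.exists_prime_and_dvd (mt orderOf_eq_one_iff.1 hχ)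
  obtain ⟨k, m, hm, hkm⟩ := Nat.exists_eq_pow_mul_and_not_dvd hexp ℓ hℓ.ne_one
  have hℓR : ¬ IsUnit (ℓ : R) :=
    hR ℓ hℓ (hℓd.trans (hord.trans Group.exponent_dvd_nat_card))
  obtain ⟨P, hPmax, hℓP⟩ := exists_max_ideal_of_mem_nonunits hℓR
  refine ⟨(Units.coeHom R).comp (χ ^ m), P, hPmax.ne_top, fun h => hm ?_, fun g => ?_⟩
  · refine hℓd.trans (orderOf_dvd_of_pow_eq_one (Units.ext ?_))
    simpa using h
  · have : Fact ℓ.Prime := ⟨hℓ⟩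
    have : CharP (R ⧸ P) ℓ := by
      refine (CharP.charP_iff_prime_eq_zero hℓ).2 ?_
      rw [← map_natCast (Ideal.Quotient.mk P), Ideal.Quotient.eq_zero_iff_mem]
      exact hℓP
    have : ExpChar (R ⧸ P) ℓ := ExpChar.prime hℓ
    rw [← Ideal.Quotient.eq_zero_iff_mem, map_sub, map_one, sub_eq_zero, eq_comm, ← pow_one
      (Ideal.Quotient.mk P _), ← ExpChar.pow_prime_pow_mul_eq_one_iff ℓ k 1, mul_one, ← map_pow]
    have h1 : (χ g ^ m) ^ ℓ ^ k = 1 := by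
      rw [← pow_mul, mul_comm, ← hkm, ← map_pow, Monoid.pow_exponent_eq_one, map_one]
    have h2 : ((Units.coeHom R).comp (χ ^ m) g) ^ ℓ ^ k = 1 := by
      simpa using congrArg Units.val h1
    rw [h2, map_one]

namespace ZbarInvP

lemma powers_le_nonZeroDivisors {p : ℕ} (hp : p ≠ 0) :
    Submonoid.powers ((p : ℕ) : integralClosure ℤ ℂ) ≤ nonZeroDivisors (integralClosure ℤ ℂ) :=
  powers_le_nonZeroDivisors_of_noZeroDivisors (Nat.cast_ne_zero.2 hp)

lemma isDomain {p : ℕ} (hp : p ≠ 0) : IsDomain (ZbarInvP p) :=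
  IsLocalization.isDomain_localization (powers_le_nonZeroDivisors hp)

lemma hasEnoughRootsOfUnity {p : ℕ} (hp : p ≠ 0) (n : ℕ) [NeZero n] :
    HasEnoughRootsOfUnity (ZbarInvP p) n where
  prim := by
    have hζ := Complex.isPrimitiveRoot_exp n (NeZero.ne n)
    let z : integralClosure ℤ ℂ := ⟨_, hζ.isIntegral (NeZero.pos n)⟩
    have hz : IsPrimitiveRoot z n :=
      IsPrimitiveRoot.of_map_of_injective (f := (integralClosure ℤ ℂ).val) hζ
        Subtype.val_injective
    exact ⟨_, hz.map_of_injective (f := algebraMap _ (ZbarInvP p))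
      (IsLocalization.injective _ (powers_le_nonZeroDivisors hp))⟩
  cyc := by
    have := isDomain hp
    exact rootsOfUnity.isCyclic _ _

lemma not_isUnit_natCast {p ℓ : ℕ} (hℓ : ℓ ≠ 1) (h : p.Coprime ℓ) :
    ¬ IsUnit (ℓ : ZbarInvP p) := by
  intro hu
  rw [← map_natCast (algebraMap (integralClosure ℤ ℂ) (ZbarInvP p))] at hu
  obtain ⟨_, ⟨n, rfl⟩, hn⟩ := (IsLocalization.algebraMap_isUnit_iff
    (Submonoid.powers ((p : ℕ) : integralClosure ℤ ℂ))).1 hu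
  have hcop : IsCoprime (ℓ : integralClosure ℤ ℂ) ((p : integralClosure ℤ ℂ) ^ n) :=
    (Nat.Coprime.cast h.symm).pow_right
  have hO : IsUnit (ℓ : integralClosure ℤ ℂ) := hcop.isUnit_of_dvd hn
  rw [← map_natCast (algebraMap ℤ (integralClosure ℤ ℂ))] at hO
  have := isUnit_of_map_unit _ _ hO
  exact hℓ (by simpa [Int.isUnit_iff_natAbs_eq] using this)

end ZbarInvP

/-- Let `p` be a prime and `A = Z̄[1/p]`.  Let `H` be a finite group and `K`
a normal subgroup of `H` such that `H/K` is abelian of order coprime to `p`.  If the group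
algebra `MonoidAlgebra A K` has no central idempotents other than `0` and `1`, then neither
does the group algebra `MonoidAlgebra A H`. -/
theorem statement10 (p : ℕ) (hp : p.Prime)
    (H : Type*) [Group H] [Finite H] (K : Subgroup H) [K.Normal]
    (habelian : ∀ x y : H ⧸ K, x * y = y * x)
    (hcoprime : Nat.Coprime p (Nat.card (H ⧸ K)))
    (hK : ∀ e : MonoidAlgebra (ZbarInvP p) ↥K,
      e ∈ Subring.center (MonoidAlgebra (ZbarInvP p) ↥K) → e * e = e → e = 0 ∨ e = 1) :
    ∀ e : MonoidAlgebra (ZbarInvP p) H,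
      e ∈ Subring.center (MonoidAlgebra (ZbarInvP p) H) → e * e = e → e = 0 ∨ e = 1 := by
  intro e he hee
  have := ZbarInvP.isDomain hp.ne_zero
  let _ : CommGroup (H ⧸ K) := { (inferInstance : Group (H ⧸ K)) with mul_comm := habelian }
  have : NeZero (Monoid.exponent (H ⧸ K)) := ⟨Monoid.exponent_ne_zero_of_finite⟩
  have := ZbarInvP.hasEnoughRootsOfUnity hp.ne_zero (Monoid.exponent (H ⧸ K))
  have hsupp : ∀ g ∉ K, e.coeff g = 0 := by
    intro g hg
    obtain ⟨ψ, P, hP, hψ, hmem⟩ := exists_monoidHom_ne_one_and_sub_one_mem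
      (R := ZbarInvP p) (q := (g : H ⧸ K))
      (fun ℓ hℓ hdvd => ZbarInvP.not_isUnit_natCast hℓ.ne_one
        (hcoprime.coprime_dvd_right hdvd))
      (mt (QuotientGroup.eq_one_iff g).1 hg)
    let f := MonoidAlgebra.twist (ψ.comp (QuotientGroup.mk' K)) e
    have hsub : ∀ x, (e - f).coeff x = (1 - ψ (x : H ⧸ K)) * e.coeff x := fun x => by
      simp [f, MonoidAlgebra.coeff_twist, sub_mul]
    have hef : e = f := MonoidAlgebra.eq_of_idempotent_of_sub_mem hP hee
      (by rw [← map_mul, hee]) (Subring.mem_center_iff.1 he f)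
      fun x => hsub x ▸ P.mul_mem_right _ (hmem x)
    have h0 := hsub g
    rw [sub_eq_zero.2 hef, MonoidAlgebra.coeff_zero, Finsupp.zero_apply] at h0
    exact (mul_eq_zero.1 h0.symm).resolve_left (sub_ne_zero.2 hψ.symm)
  obtain ⟨e', he', rfl⟩ := MonoidAlgebra.exists_central_mapDomain_eq K he hsupp
  have hidem : e' * e' = e' := by
    apply MonoidAlgebra.mapDomain_injective (R := ZbarInvP p) K.subtype_injective
    exact (map_mul (MonoidAlgebra.mapDomainRingHom _ K.subtype) e' e').trans hee
  rcases hK e' he' hidem with rfl | rfl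
  · exact .inl (map_zero _)
  · exact .inr (map_one _)
end
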